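/- Let w be a hyperbolic isometry of E = ℝⁿ with reflection length ℓ(w) = k, write Mov(w) = U + μ in standard form, let r be a reflection with root α, and let U_α denote the linear span of U ∪ {α}. If α ∉ U and μ ∈ U_α, then the isometry rw is elliptic and ℓ(rw) = k − 1. -/

import Mathlib

open scoped RealInnerProductSpace

noncomputable section

/-- `n`-dimensional euclidean space `E = ℝⁿ` (also used as the vector space `V` of
translations). -/
abbrev Euc (n : ℕ) := EuclideanSpace ℝ (Fin n)

/-- An isometry of `E`: a surjective distance-preserving map of `E` to itself
(such a map is automatically an affine bijection). -/
abbrev Iso (n : ℕ) := Euc n ≃ᵢ Euc n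

/-- The move-set `Mov(w) = { w(x) - x : x ∈ E } ⊆ V`. -/
def MovSet (n : ℕ) (w : Iso n) : Set (Euc n) := {v | ∃ x, w x - x = v}

/-- The fix-set `Fix(w) = { x ∈ E : w(x) = x }`. -/
def FixSet (n : ℕ) (w : Iso n) : Set (Euc n) := {x | w x = x}

/-- A reflection: a nontrivial isometry fixing pointwise an affine hyperplane,
i.e. a nonempty affine subspace of codimension one. -/
def IsReflection (n : ℕ) (r : Iso n) : Prop :=
  r ≠ 1 ∧ ∃ H : AffineSubspace ℝ (Euc n), (H : Set (Euc n)).Nonempty ∧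
    Module.finrank ℝ H.direction + 1 = n ∧ ∀ x ∈ H, r x = x

/-- The reflection length `ℓ(w)`: the least `k` such that `w` is a product of `k`
reflections. -/
def reflLen (n : ℕ) (w : Iso n) : ℕ :=
  sInf {k | ∃ l : List (Iso n), l.length = k ∧ (∀ r ∈ l, IsReflection n r) ∧ l.prod = w}

/-- `u` lies in the interval `[1, w]`:  `ℓ(u) + ℓ(u⁻¹w) = ℓ(w)`. -/
def inInterval (n : ℕ) (w u : Iso n) : Prop :=
  reflLen n u + reflLen n (u⁻¹ * w) = reflLen n w

/-- The betweenness partial order on the interval `[1, w]`: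
`u ≤ v` iff `ℓ(u) + ℓ(u⁻¹v) + ℓ(v⁻¹w) = ℓ(w)`. -/
def intervalLE (n : ℕ) (w u v : Iso n) : Prop :=
  reflLen n u + reflLen n (u⁻¹ * v) + reflLen n (v⁻¹ * w) = reflLen n w

/-- The set of directions `Dir(S) = { m - m' : m, m' ∈ S }` of a subset `S`. -/
def dirSet (n : ℕ) (S : Set (Euc n)) : Set (Euc n) := {d | ∃ m ∈ S, ∃ m' ∈ S, d = m - m'}

/-- `α` is a root of the reflection `r`: a nonzero vector orthogonal to the
direction space of the fixed hyperplane of `r`. -/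
def IsRoot (n : ℕ) (r : Iso n) (α : Euc n) : Prop :=
  α ≠ 0 ∧ ∀ x y : Euc n, r x = x → r y = y → ⟪α, y - x⟫ = 0

open Module

/-- The linear part of an isometry of `E`. -/
def linPart {n : ℕ} (w : Iso n) : Euc n ≃ₗᵢ[ℝ] Euc n :=
  w.toRealAffineIsometryEquiv.linearIsometryEquiv

theorem linPart_sub {n : ℕ} (w : Iso n) (x y : Euc n) : linPart w (x - y) = w x - w y := by
  exact w.toRealAffineIsometryEquiv.map_vsub x y

theorem apply_add_eq {n : ℕ} (w : Iso n) (x v : Euc n) : w (x + v) = w x + linPart w v := by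
  have := linPart_sub w (x + v) x
  rw [add_sub_cancel_left] at this
  rw [this]
  abel

theorem reflection_orthogonal_singleton_apply {n : ℕ} (α v : Euc n) :
    (ℝ ∙ α)ᗮ.reflection v = v - (2 * (⟪α, v⟫ / ⟪α, α⟫)) • α := by
  rw [Submodule.reflection_orthogonal_apply, Submodule.reflection_singleton_apply,
    real_inner_self_eq_norm_sq, neg_sub, mul_smul, two_smul, two_smul]
  rfl

theorem finrank_orthogonal_singleton_add_one {n : ℕ} {α : Euc n} (hα : α ≠ 0) :
    finrank ℝ (ℝ ∙ α)ᗮ + 1 = n := by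
  have := (ℝ ∙ α).finrank_add_finrank_orthogonal
  rw [finrank_span_singleton hα, finrank_euclideanSpace_fin] at this
  omega

/-- A nontrivial linear isometry fixing the hyperplane `D` pointwise is the orthogonal
reflection along any normal vector of `D`. -/
theorem eq_reflection_of_fixes {n : ℕ} {L : Euc n ≃ₗᵢ[ℝ] Euc n} {D : Submodule ℝ (Euc n)}
    (hD : finrank ℝ D + 1 = n) (hfix : ∀ d ∈ D, L d = d) (hne : ∃ v, L v ≠ v)
    {α : Euc n} (hα0 : α ≠ 0) (hα : α ∈ Dᗮ) (v : Euc n) :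
    L v = (ℝ ∙ α)ᗮ.reflection v := by
  have hDα : D = (ℝ ∙ α)ᗮ := by
    apply Submodule.eq_of_le_of_finrank_eq
    · intro d hd
      rw [Submodule.mem_orthogonal_singleton_iff_inner_right, real_inner_comm]
      exact hα d hd
    · have := finrank_orthogonal_singleton_add_one hα0
      omega
  have hαα : ⟪α, α⟫ ≠ 0 := inner_self_ne_zero.mpr hα0
  have hdec : ∀ v, L v = v - (⟪α, v⟫ / ⟪α, α⟫) • α + (⟪α, v⟫ / ⟪α, α⟫) • L α := by
    intro v
    have hd : v - (⟪α, v⟫ / ⟪α, α⟫) • α ∈ D := by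
      rw [hDα, Submodule.mem_orthogonal_singleton_iff_inner_right, inner_sub_right,
        inner_smul_right, div_mul_cancel₀ _ hαα, sub_self]
    have := hfix _ hd
    rw [map_sub, map_smul] at this
    rw [← this]
    abel
  have hLα : L α ∈ ℝ ∙ α := by
    rw [← (ℝ ∙ α).orthogonal_orthogonal, ← hDα]
    intro d hd
    rw [← hfix d hd, L.inner_map_map]
    exact hα d hd
  obtain ⟨c, hc⟩ := Submodule.mem_span_singleton.mp hLα
  have hc2 : c * c = 1 := by
    have h := L.inner_map_map α α
    rw [← hc, inner_smul_left, inner_smul_right, ← mul_assoc] at h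
    simpa using mul_right_cancel₀ hαα (h.trans (one_mul _).symm)
  rcases mul_self_eq_one_iff.mp hc2 with rfl | rfl
  · obtain ⟨u, hu⟩ := hne
    refine absurd ?_ hu
    rw [hdec u, ← hc]
    simp
  · rw [hdec v, ← hc, reflection_orthogonal_singleton_apply, two_mul, add_smul]
    module

theorem IsReflection.apply_eq_of_mem_orthogonal {n : ℕ} {r : Iso n} (hr1 : r ≠ 1)
    {H : AffineSubspace ℝ (Euc n)} (hH : finrank ℝ H.direction + 1 = n)
    (hfix : ∀ x ∈ H, r x = x) {p : Euc n} (hp : p ∈ H) {α : Euc n} (hα0 : α ≠ 0)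
    (hα : α ∈ H.directionᗮ) (x : Euc n) :
    r x = p + (ℝ ∙ α)ᗮ.reflection (x - p) := by
  have key : ∀ x, r x = p + linPart r (x - p) := by
    intro x
    rw [linPart_sub, hfix p hp]
    abel
  rw [key, eq_reflection_of_fixes hH (L := linPart r) ?_ ?_ hα0 hα]
  · intro d hd
    have h := hfix _ (AffineSubspace.vadd_mem_of_mem_direction hd hp)
    rw [vadd_eq_add, key, add_sub_cancel_right] at h
    rw [add_comm] at h
    exact add_right_cancel h
  · by_contra! h
    apply hr1
    ext1 x
    rw [key, h]
    simp

theorem IsReflection.apply_eq {n : ℕ} {r : Iso n} (hr : IsReflection n r) {α : Euc n}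
    (hα : IsRoot n r α) : ∃ p, ∀ x, r x = p + (ℝ ∙ α)ᗮ.reflection (x - p) := by
  obtain ⟨hr1, H, ⟨p, hp⟩, hH, hfix⟩ := hr
  refine ⟨p, IsReflection.apply_eq_of_mem_orthogonal hr1 hH hfix hp hα.1 ?_⟩
  intro d hd
  have h := hα.2 p (d +ᵥ p) (hfix p hp)
    (hfix _ (AffineSubspace.vadd_mem_of_mem_direction hd hp))
  rwa [vadd_eq_add, add_sub_cancel_right, real_inner_comm] at h

theorem IsReflection.exists_apply_eq {n : ℕ} {r : Iso n} (hr : IsReflection n r) :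
    ∃ α p : Euc n, ∀ x, r x = p + (ℝ ∙ α)ᗮ.reflection (x - p) := by
  obtain ⟨hr1, H, ⟨p, hp⟩, hH, hfix⟩ := hr
  have hpos : 0 < finrank ℝ H.directionᗮ := by
    have := H.direction.finrank_add_finrank_orthogonal
    rw [finrank_euclideanSpace_fin] at this
    omega
  have := finrank_pos_iff.mp hpos
  obtain ⟨⟨α, hα⟩, hne⟩ := exists_ne (0 : H.directionᗮ)
  exact ⟨α, p, IsReflection.apply_eq_of_mem_orthogonal hr1 hH hfix hp
    (fun h => hne (Subtype.ext h)) hα⟩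

theorem IsReflection.mul_self {n : ℕ} {r : Iso n} (hr : IsReflection n r) : r * r = 1 := by
  obtain ⟨α, p, h⟩ := hr.exists_apply_eq
  ext1 x
  rw [IsometryEquiv.mul_apply, h (r x), h x, add_sub_cancel_left, Submodule.reflection_reflection]
  simp

/-- The orthogonal reflection along `α` through the point `p`. -/
def reflThrough {n : ℕ} (p α : Euc n) : Iso n :=
  ((IsometryEquiv.vaddConst p).symm.trans (ℝ ∙ α)ᗮ.reflection.toIsometryEquiv).trans
    (IsometryEquiv.vaddConst p)

theorem reflThrough_apply {n : ℕ} (p α x : Euc n) :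
    reflThrough p α x = p + (ℝ ∙ α)ᗮ.reflection (x - p) :=
  add_comm _ _

theorem isReflection_reflThrough {n : ℕ} (p : Euc n) {α : Euc n} (hα : α ≠ 0) :
    IsReflection n (reflThrough p α) := by
  refine ⟨fun h => hα ?_, AffineSubspace.mk' p (ℝ ∙ α)ᗮ, ⟨p, AffineSubspace.self_mem_mk' _ _⟩,
    ?_, fun x hx => ?_⟩
  · have h2 := DFunLike.congr_fun h (p + α)
    rw [reflThrough_apply, add_sub_cancel_left,
      Submodule.reflection_orthogonalComplement_singleton_eq_neg] at h2
    have h3 : (2 : ℝ) • α = 0 := by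
      rw [two_smul]
      exact neg_eq_iff_add_eq_zero.mp (add_left_cancel h2)
    exact (smul_eq_zero.mp h3).resolve_left two_ne_zero
  · rw [AffineSubspace.direction_mk']
    exact finrank_orthogonal_singleton_add_one hα
  · rw [AffineSubspace.mem_mk', vsub_eq_sub] at hx
    rw [reflThrough_apply, Submodule.reflection_mem_subspace_eq_self hx, add_sub_cancel]

theorem exists_reflections_of_linear {n : ℕ} (p : Euc n) (l : List (Euc n)) :
    ∃ l' : List (Iso n), l'.length ≤ l.length ∧ (∀ r ∈ l', IsReflection n r) ∧
      ∀ x, l'.prod x = p + (l.map fun v => (ℝ ∙ v)ᗮ.reflection).prod (x - p) := by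
  induction l with
  | nil => exact ⟨[], le_rfl, by simp, by simp⟩
  | cons α l ih =>
    obtain ⟨l', hlen, hl', hprod⟩ := ih
    by_cases hα : α = 0
    · refine ⟨l', hlen.trans (by simp), hl', fun x => ?_⟩
      rw [hprod, hα, List.map_cons, List.prod_cons, LinearIsometryEquiv.coe_mul,
        Function.comp_apply, reflection_orthogonal_singleton_apply, smul_zero, sub_zero]
    · refine ⟨reflThrough p α :: l', by simpa using hlen, ?_, fun x => ?_⟩
      · rintro r (_ | ⟨_, hr⟩)
        · exact isReflection_reflThrough p hα
        · exact hl' r hr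
      · rw [List.prod_cons, IsometryEquiv.mul_apply, hprod, reflThrough_apply,
          add_sub_cancel_left]
        rfl

/-- An elliptic isometry with all displacements in `W` is a product of at most `dim W`
reflections. -/
theorem exists_reflections_of_fixed {n : ℕ} (g : Iso n) {p : Euc n} (hp : g p = p)
    (W : Submodule ℝ (Euc n)) (hW : ∀ x, g x - x ∈ W) :
    ∃ l : List (Iso n), l.length ≤ finrank ℝ W ∧ (∀ r ∈ l, IsReflection n r) ∧
      l.prod = g := by
  let T : Euc n →L[ℝ] Euc n := ContinuousLinearMap.id ℝ (Euc n) - linPart g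
  have hT : finrank ℝ T.kerᗮ ≤ finrank ℝ W := by
    have hrange : LinearMap.range (T : Euc n →ₗ[ℝ] Euc n) ≤ W := by
      rintro _ ⟨v, rfl⟩
      have h := W.neg_mem (hW (p + v))
      rw [apply_add_eq, hp, add_sub_add_left_eq_sub, neg_sub] at h
      exact h
    have h1 := (T : Euc n →ₗ[ℝ] Euc n).finrank_range_add_finrank_ker
    have h2 := T.ker.finrank_add_finrank_orthogonal
    have h3 := Submodule.finrank_mono hrange
    omega
  obtain ⟨l, hl, hprod⟩ := (linPart g).reflections_generate_dim_aux hT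
  obtain ⟨l', hlen, hl', hprod'⟩ := exists_reflections_of_linear p l
  refine ⟨l', hlen.trans hl, hl', ?_⟩
  ext1 x
  rw [hprod', ← hprod, linPart_sub, hp]
  abel

theorem reflLen_le_length {n : ℕ} {l : List (Iso n)} (hl : ∀ r ∈ l, IsReflection n r) :
    reflLen n l.prod ≤ l.length :=
  Nat.sInf_le ⟨l, rfl, hl, rfl⟩

theorem exists_length_eq_reflLen {n : ℕ} {l : List (Iso n)} (hl : ∀ r ∈ l, IsReflection n r) :
    ∃ l' : List (Iso n), l'.length = reflLen n l.prod ∧ (∀ r ∈ l', IsReflection n r) ∧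
      l'.prod = l.prod :=
  Nat.sInf_mem (s := {k | ∃ l' : List (Iso n), l'.length = k ∧ (∀ r ∈ l', IsReflection n r) ∧
    l'.prod = l.prod}) ⟨_, l, rfl, hl, rfl⟩

/-- Prescribed inner products with a linearly independent family can be realized. -/
theorem LinearIndependent.exists_inner_eq {n : ℕ} {ι : Type*} {f : ι → Euc n}
    (hf : LinearIndependent ℝ f) (c : ι → ℝ) : ∃ x, ∀ i, ⟪f i, x⟫ = c i := by
  obtain ⟨g, hg⟩ := LinearMap.exists_extend
    ((Finsupp.linearCombination ℝ c).comp hf.repr)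
  refine ⟨(InnerProductSpace.toDual ℝ (Euc n)).symm g.toContinuousLinearMap, fun i => ?_⟩
  rw [real_inner_comm, InnerProductSpace.toDual_symm_apply]
  have hi := LinearMap.congr_fun hg ⟨f i, Submodule.subset_span ⟨i, rfl⟩⟩
  simpa [hf.repr_eq_single i] using hi

theorem prod_apply_eq_self {n : ℕ} {l : List (Iso n)} {x : Euc n} (h : ∀ r ∈ l, r x = x) :
    l.prod x = x := by
  induction l with
  | nil => rfl
  | cons r l ih =>
    rw [List.prod_cons, IsometryEquiv.mul_apply, ih fun s hs => h s (List.mem_cons_of_mem _ hs)]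
    exact h r List.mem_cons_self

theorem prod_apply_sub_mem {n : ℕ} {l : List (Iso n)} {W : Submodule ℝ (Euc n)}
    (h : ∀ r ∈ l, ∀ x, r x - x ∈ W) (x : Euc n) : l.prod x - x ∈ W := by
  induction l with
  | nil => simp
  | cons r l ih =>
    have h1 := h r List.mem_cons_self (l.prod x)
    have h2 := W.add_mem h1 (ih fun s hs => h s (List.mem_cons_of_mem _ hs))
    rwa [sub_add_sub_cancel] at h2

theorem add_reflection_sub {n : ℕ} (p α x : Euc n) :
    p + (ℝ ∙ α)ᗮ.reflection (x - p) = x - (2 * (⟪α, x - p⟫ / ⟪α, α⟫)) • α := by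
  rw [reflection_orthogonal_singleton_apply]
  abel

/-- The displacements of a product of reflections without fixed point span a space of
dimension smaller than the number of factors. -/
theorem exists_finrank_lt_length {n : ℕ} {l : List (Iso n)} (hl : ∀ r ∈ l, IsReflection n r)
    (hfix : ∀ x, l.prod x ≠ x) :
    ∃ W : Submodule ℝ (Euc n), finrank ℝ W < l.length ∧ ∀ x, l.prod x - x ∈ W := by
  have hex : ∀ i : Fin l.length, ∃ α p : Euc n, ∀ x,
      l.get i x = p + (ℝ ∙ α)ᗮ.reflection (x - p) :=
    fun i => (hl _ (l.get_mem i)).exists_apply_eq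
  choose α p h using hex
  refine ⟨Submodule.span ℝ (Set.range α), lt_of_le_of_ne ?_ fun heq => ?_, ?_⟩
  · simpa [Set.finrank] using finrank_range_le_card (R := ℝ) α
  · have hli : LinearIndependent ℝ α := by
      rw [linearIndependent_iff_card_eq_finrank_span, Set.finrank, heq, Fintype.card_fin]
    obtain ⟨x, hx⟩ := hli.exists_inner_eq fun i => ⟪α i, p i⟫
    refine hfix x (prod_apply_eq_self fun r hr => ?_)
    obtain ⟨i, rfl⟩ := List.mem_iff_get.mp hr
    rw [h, add_reflection_sub, inner_sub_right, hx]
    simp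
  · refine prod_apply_sub_mem fun r hr x => ?_
    obtain ⟨i, rfl⟩ := List.mem_iff_get.mp hr
    rw [h, add_reflection_sub, sub_sub_cancel_left]
    exact Submodule.neg_mem _ (Submodule.smul_mem _ _ (Submodule.subset_span ⟨i, rfl⟩))

theorem linPart_sub_self_mem_dirSet {n : ℕ} (w : Iso n) (v : Euc n) :
    linPart w v - v ∈ dirSet n (MovSet n w) := by
  refine ⟨_, ⟨v, rfl⟩, _, ⟨0, rfl⟩, ?_⟩
  have := linPart_sub w v 0
  rw [sub_zero] at this
  rw [this]
  abel

theorem exists_linPart_sub_self_of_mem_dirSet {n : ℕ} {w : Iso n} {u : Euc n}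
    (hu : u ∈ dirSet n (MovSet n w)) : ∃ v, u = linPart w v - v := by
  obtain ⟨_, ⟨x, rfl⟩, _, ⟨y, rfl⟩, rfl⟩ := hu
  refine ⟨x - y, ?_⟩
  rw [linPart_sub]
  abel

theorem add_mem_movSet {n : ℕ} {w : Iso n} {m u : Euc n} (hm : m ∈ MovSet n w)
    (hu : u ∈ dirSet n (MovSet n w)) : m + u ∈ MovSet n w := by
  obtain ⟨x, rfl⟩ := hm
  obtain ⟨v, rfl⟩ := exists_linPart_sub_self_of_mem_dirSet hu
  refine ⟨x + v, ?_⟩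
  rw [apply_add_eq]
  abel

/-- A vector orthogonal to `Dir(Mov(w))` is fixed by the linear part of `w`. -/
theorem linPart_eq_self_of_mem_orthogonal {n : ℕ} {w : Iso n} {U : Submodule ℝ (Euc n)}
    (hU : (U : Set (Euc n)) = dirSet n (MovSet n w)) {v : Euc n} (hv : v ∈ Uᗮ) :
    linPart w v = v := by
  have hmem : linPart w v - v ∈ U := by
    rw [← SetLike.mem_coe, hU]
    exact linPart_sub_self_mem_dirSet w v
  have h0 : ⟪linPart w v, v⟫ - ⟪v, v⟫ = 0 := by
    rw [← inner_sub_left]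
    exact hv _ hmem
  rw [← sub_eq_zero, ← inner_self_eq_zero (𝕜 := ℝ), inner_sub_left, inner_sub_right,
    inner_sub_right, LinearIsometryEquiv.inner_map_map, real_inner_comm (linPart w v) v]
  linarith

/-- If a point is moved by `w` along a root of `r`, and the linear part of `w` fixes a vector
which is not orthogonal to that root, then `r * w` has a fixed point. -/
theorem exists_fixed_mul {n : ℕ} {w r : Iso n} {α p x₀ v : Euc n} {c : ℝ} (hα : α ≠ 0)
    (hr : ∀ x, r x = p + (ℝ ∙ α)ᗮ.reflection (x - p)) (hx₀ : w x₀ - x₀ = c • α)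
    (hv : linPart w v = v) (hαv : ⟪α, v⟫ ≠ 0) : ∃ x, (r * w) x = x := by
  have hαα : ⟪α, α⟫ ≠ 0 := inner_self_ne_zero.mpr hα
  let t : ℝ := -(⟪α, x₀ - p⟫ + c / 2 * ⟪α, α⟫) / ⟪α, v⟫
  have hw : w (x₀ + t • v) = x₀ + t • v + c • α := by
    rw [apply_add_eq, map_smul, hv, ← hx₀]
    abel
  refine ⟨x₀ + t • v, ?_⟩
  have hcoef : 2 * (⟪α, x₀ + t • v + c • α - p⟫ / ⟪α, α⟫) = c := by
    have : x₀ + t • v + c • α - p = (x₀ - p) + t • v + c • α := by abel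
    rw [this, inner_add_right, inner_add_right, inner_smul_right, inner_smul_right]
    simp only [t]
    field_simp
    ring
  rw [IsometryEquiv.mul_apply, hw, hr, add_reflection_sub, hcoef, add_sub_cancel_right]

/-- `w` hyperbolic with `ℓ(w) = k`, `Mov(w) = U + μ` in standard form,
`r` a reflection with root `α`, `U_α` the span of `U ∪ {α}`.  If `α ∉ U` and
`μ ∈ U_α` then `rw` is elliptic with `ℓ(rw) = k − 1`. -/
theorem mult_by_reflection_mu_in_Ualpha (n k : ℕ) (w r : Iso n)
    (U : Submodule ℝ (Euc n)) (μ α : Euc n)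
    (hhyp : (0 : Euc n) ∉ MovSet n w)
    (hk : reflLen n w = k)
    (hU : (U : Set (Euc n)) = dirSet n (MovSet n w))
    (hμmem : μ ∈ MovSet n w) (hμperp : μ ∈ Uᗮ)
    (hr : IsReflection n r) (hroot : IsRoot n r α)
    (hα : α ∉ U) (hμα : μ ∈ U ⊔ Submodule.span ℝ {α}) :
    (0 : Euc n) ∈ MovSet n (r * w) ∧ reflLen n (r * w) = k - 1 := by
  have hα0 : α ≠ 0 := hroot.1
  obtain ⟨p, hrp⟩ := hr.apply_eq hroot
  have hUmem : ∀ u, u ∈ U ↔ u ∈ dirSet n (MovSet n w) := fun u => by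
    rw [← SetLike.mem_coe, hU]
  obtain ⟨x, hx⟩ : ∃ x, (r * w) x = x := by
    obtain ⟨u, hu, y, hy, hsum⟩ := Submodule.mem_sup.mp hμα
    obtain ⟨c, rfl⟩ := Submodule.mem_span_singleton.mp hy
    obtain ⟨x₀, hx₀⟩ : c • α ∈ MovSet n w := by
      have := add_mem_movSet hμmem ((hUmem _).mp (U.neg_mem hu))
      rwa [← hsum, add_neg_cancel_comm] at this
    obtain ⟨v, hv, hne⟩ : ∃ v ∈ Uᗮ, ⟪α, v⟫ ≠ 0 := by
      by_contra! h
      apply hα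
      rw [← U.orthogonal_orthogonal]
      intro v hv
      rw [real_inner_comm]
      exact h v hv
    exact exists_fixed_mul hα0 hrp hx₀ (linPart_eq_self_of_mem_orthogonal hU hv) hne
  have hmov : ∀ y, (r * w) y - y ∈ U ⊔ ℝ ∙ α := by
    intro y
    have h1 : r (w y) - w y ∈ U ⊔ ℝ ∙ α := by
      rw [hrp, add_reflection_sub, sub_sub_cancel_left]
      exact Submodule.neg_mem _ (Submodule.smul_mem _ _
        (Submodule.mem_sup_right (Submodule.mem_span_singleton_self α)))
    have h2 : w y - y - μ ∈ U ⊔ ℝ ∙ α :=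
      Submodule.mem_sup_left ((hUmem _).mpr ⟨_, ⟨y, rfl⟩, _, hμmem, rfl⟩)
    have h3 := Submodule.add_mem _ h1 (Submodule.add_mem _ h2 hμα)
    rwa [sub_add_cancel, sub_add_sub_cancel] at h3
  obtain ⟨l, hlen, hl, hprod⟩ := exists_reflections_of_fixed (r * w) hx _ hmov
  have hdim : finrank ℝ ↥(U ⊔ ℝ ∙ α) ≤ finrank ℝ U + 1 := by
    have := Submodule.finrank_add_le_finrank_add_finrank U (ℝ ∙ α)
    rwa [finrank_span_singleton hα0] at this
  have hcons : ∀ l' : List (Iso n), l'.prod = r * w → (r :: l').prod = w := by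
    intro l' h
    rw [List.prod_cons, h, ← mul_assoc, hr.mul_self, one_mul]
  have hconsr : ∀ l' : List (Iso n), (∀ s ∈ l', IsReflection n s) →
      ∀ s ∈ r :: l', IsReflection n s := by
    rintro l' h s (_ | ⟨_, hs⟩)
    exacts [hr, h s hs]
  have hupper : reflLen n (r * w) ≤ finrank ℝ U + 1 := by
    rw [← hprod]
    exact (reflLen_le_length hl).trans (hlen.trans hdim)
  have hlower : k ≤ reflLen n (r * w) + 1 := by
    obtain ⟨l', hlen', hl', hprod'⟩ := exists_length_eq_reflLen hl
    have := reflLen_le_length (hconsr l' hl')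
    rwa [hcons l' (hprod'.trans hprod), hk, List.length_cons, hlen', hprod] at this
  have hhyper : finrank ℝ U + 2 ≤ k := by
    obtain ⟨l', hlen', hl', hprod'⟩ := exists_length_eq_reflLen (hconsr l hl)
    rw [hcons l hprod] at hlen' hprod'
    obtain ⟨W, hW, hWmem⟩ := exists_finrank_lt_length hl' fun y hy =>
      hhyp ⟨y, by rw [← hprod', hy, sub_self]⟩
    rw [hprod'] at hWmem
    have hMov : ∀ m ∈ MovSet n w, m ∈ W := by
      rintro _ ⟨y, rfl⟩
      exact hWmem y
    have hUW : U < W := by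
      refine lt_of_le_of_ne (fun u hu => ?_) fun heq => ?_
      · obtain ⟨m, hm, m', hm', rfl⟩ := (hUmem u).mp hu
        exact W.sub_mem (hMov m hm) (hMov m' hm')
      · have hμU : μ ∈ U := heq ▸ hMov μ hμmem
        have hμ0 : μ = 0 := inner_self_eq_zero.mp (hμperp μ hμU)
        exact hhyp (hμ0 ▸ hμmem)
    have := Submodule.finrank_lt_finrank_of_lt hUW
    omega
  exact ⟨⟨x, by rw [hx, sub_self]⟩, by omega⟩
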